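/- Let d ≥ 4 be an integer and let P ⊂ ℝ^d be a canonical Fano polytope. Then vol(P*) ≤ 2(s_d − 1)^2 / d!. -/

import Mathlib

open MeasureTheory Set
open scoped ENNReal

/-- The Sylvester sequence, 0-indexed: `sylvester 0 = 2 = s₁`,
`sylvester (n+1) = (sylvester n)^2 - sylvester n + 1`, so that `sₙ = sylvester (n-1)`. -/
def sylvester : ℕ → ℕ
  | 0 => 2
  | n + 1 => (sylvester n) ^ 2 - sylvester n + 1

/-- A point of `ℝ^d` is a lattice point if all its coordinates are integers. -/
def IsLatticePt {d : ℕ} (x : Fin d → ℝ) : Prop := ∀ i, ∃ z : ℤ, x i = (z : ℝ)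

/-- A lattice polytope: the convex hull of finitely many lattice points. -/
def IsLatticePolytope {d : ℕ} (P : Set (Fin d → ℝ)) : Prop :=
  ∃ V : Finset (Fin d → ℝ), (∀ v ∈ V, IsLatticePt v) ∧ P = convexHull ℝ (V : Set (Fin d → ℝ))

/-- A canonical Fano polytope in `ℝ^d`: a lattice polytope (automatically of full
dimension `d`) whose interior contains exactly one lattice point, namely the origin. -/
def IsCanonicalFano {d : ℕ} (P : Set (Fin d → ℝ)) : Prop :=
  IsLatticePolytope P ∧ {x ∈ interior P | IsLatticePt x} = {0}

/-- The dual (polar) of a set `P ⊆ ℝ^d`: all `y` with `⟨y, x⟩ ≥ -1` for every `x ∈ P`. -/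
def polarDual {d : ℕ} (P : Set (Fin d → ℝ)) : Set (Fin d → ℝ) :=
  {y | ∀ x ∈ P, -1 ≤ ∑ i, y i * x i}

theorem two_le_sylvester (n : ℕ) : 2 ≤ sylvester n := by
  induction n with
  | zero => rfl
  | succ n ih =>
    have : sylvester n * 2 ≤ sylvester n ^ 2 := by rw [sq]; exact Nat.mul_le_mul_left _ ih
    simp only [sylvester]
    omega

theorem sylvester_succ_sub_one (n : ℕ) :
    (sylvester (n + 1) : ℝ) - 1 = sylvester n * ((sylvester n : ℝ) - 1) := by
  have : sylvester n ≤ sylvester n ^ 2 := Nat.le_self_pow (by norm_num) _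
  simp only [sylvester]
  push_cast [this]
  ring

theorem one_le_sylvester_sub_one (n : ℕ) : (1 : ℝ) ≤ (sylvester n : ℝ) - 1 := by
  have : (2 : ℝ) ≤ sylvester n := by exact_mod_cast two_le_sylvester n
  linarith

theorem sylvester_pos (n : ℕ) : (0 : ℝ) < sylvester n := by
  linarith [one_le_sylvester_sub_one n]

theorem sylvester_le_succ (n : ℕ) : sylvester n ≤ sylvester (n + 1) := by
  have h := sylvester_succ_sub_one n
  have h1 := one_le_sylvester_sub_one n
  have : (sylvester n : ℝ) ≤ sylvester (n + 1) := by nlinarith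
  exact_mod_cast this

theorem sylvester_monotone : Monotone sylvester := monotone_nat_of_le_succ sylvester_le_succ

theorem prod_inv_sylvester (m : ℕ) :
    ∏ i ∈ Finset.range m, ((sylvester i : ℝ))⁻¹ = ((sylvester m : ℝ) - 1)⁻¹ := by
  induction m with
  | zero => norm_num [sylvester]
  | succ m ih => rw [Finset.prod_range_succ, ih, sylvester_succ_sub_one, mul_inv, mul_comm]

theorem sum_inv_sylvester (m : ℕ) :
    ∑ i ∈ Finset.range m, ((sylvester i : ℝ))⁻¹ = 1 - ((sylvester m : ℝ) - 1)⁻¹ := by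
  induction m with
  | zero => norm_num [sylvester]
  | succ m ih =>
    have h1 := one_le_sylvester_sub_one m
    have h2 := sylvester_pos m
    have h3 : (sylvester m : ℝ) - 1 ≠ 0 := by linarith
    rw [Finset.sum_range_succ, ih, sylvester_succ_sub_one]
    field_simp
    ring

theorem mul_sum_Ico_le_sum_mul {N : ℕ} {w δ : ℕ → ℝ} (hw : ∀ i, i + 1 < N → w i ≤ w (i + 1))
    (hδ : ∀ j < N, 0 ≤ ∑ i ∈ Finset.Ico j N, δ i) {j : ℕ} (hj : j < N) :
    w j * ∑ i ∈ Finset.Ico j N, δ i ≤ ∑ i ∈ Finset.Ico j N, w i * δ i := by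
  obtain ⟨k, rfl⟩ : ∃ k, N = j + 1 + k := ⟨N - (j + 1), by omega⟩
  induction k generalizing j with
  | zero => simp
  | succ k ih =>
    have e : j + 1 + (k + 1) = (j + 1) + 1 + k := by ring
    rw [e] at hw hδ ⊢
    have h1 := ih hw hδ (j := j + 1) (by omega)
    rw [Finset.sum_eq_sum_Ico_succ_bot (by omega : j < j + 1 + 1 + k) δ,
      Finset.sum_eq_sum_Ico_succ_bot (by omega : j < j + 1 + 1 + k) fun i => w i * δ i]
    have h2 := mul_le_mul_of_nonneg_right (hw j (by omega)) (hδ (j + 1) (by omega))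
    linarith

/-- If the tail sums of a positive antitone sequence `x` dominate those of `y`, then so does
its product. -/
theorem prod_le_prod_of_tail_sum_le {N : ℕ} {x y : ℕ → ℝ} (hx : ∀ i < N, 0 < x i)
    (hy : ∀ i < N, 0 ≤ y i) (hanti : ∀ i, i + 1 < N → x (i + 1) ≤ x i)
    (h : ∀ j < N, ∑ i ∈ Finset.Ico j N, y i ≤ ∑ i ∈ Finset.Ico j N, x i) :
    ∏ i ∈ Finset.range N, y i ≤ ∏ i ∈ Finset.range N, x i := by
  rcases Nat.eq_zero_or_pos N with rfl | hN
  · simp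
  have hsum : 0 ≤ ∑ i ∈ Finset.range N, (x i)⁻¹ * (x i - y i) := by
    rw [Finset.range_eq_Ico]
    refine le_trans ?_ (mul_sum_Ico_le_sum_mul (w := fun i => (x i)⁻¹) ?_ ?_ hN)
    · refine mul_nonneg (inv_nonneg.2 (hx 0 hN).le) ?_
      rw [Finset.sum_sub_distrib]
      linarith [h 0 hN]
    · intro i hi
      exact inv_anti₀ (hx _ hi) (hanti i hi)
    · intro j hj
      rw [Finset.sum_sub_distrib]
      linarith [h j hj]
  have hpos : 0 < ∏ i ∈ Finset.range N, x i :=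
    Finset.prod_pos fun i hi => hx i (Finset.mem_range.1 hi)
  rw [← div_le_one hpos, ← Finset.prod_div_distrib]
  calc ∏ i ∈ Finset.range N, y i / x i
      ≤ ∏ i ∈ Finset.range N, Real.exp (-((x i)⁻¹ * (x i - y i))) := by
        refine Finset.prod_le_prod (fun i hi => ?_) (fun i hi => ?_)
        · have hi := Finset.mem_range.1 hi
          exact div_nonneg (hy i hi) (hx i hi).le
        · have hi := hx i (Finset.mem_range.1 hi)
          refine le_trans (le_of_eq ?_) (Real.add_one_le_exp _)
          field_simp
          ring
    _ = Real.exp (-∑ i ∈ Finset.range N, (x i)⁻¹ * (x i - y i)) := by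
        rw [← Real.exp_sum, Finset.sum_neg_distrib]
    _ ≤ 1 := Real.exp_le_one_iff.2 (by linarith)

/-- The product-sum inequalities satisfied by the barycentric coordinates, in decreasing order,
of the unique interior lattice point of a lattice simplex. -/
structure ProductSum (n : ℕ) (x : ℕ → ℝ) : Prop where
  pos : ∀ i < n, 0 < x i
  anti : ∀ i, i + 1 < n → x (i + 1) ≤ x i
  sum_eq : ∑ i ∈ Finset.range n, x i = 1
  prod_le : ∀ m < n, ∏ i ∈ Finset.range m, x i ≤ ∑ i ∈ Finset.Ico m n, x i

theorem ProductSum.inv_le_sum {n : ℕ} {x : ℕ → ℝ} (h : ProductSum n x) :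
    ∀ m < n, ((sylvester m : ℝ) - 1)⁻¹ ≤ ∑ i ∈ Finset.Ico m n, x i := by
  intro m
  induction m using Nat.strong_induction_on with
  | _ m ih =>
    intro hm
    by_contra! hlt
    have key : ∀ j ≤ m, ∑ i ∈ Finset.Ico j m, x i =
        ∑ i ∈ Finset.Ico j n, x i - ∑ i ∈ Finset.Ico m n, x i := fun j hj => by
      rw [← Finset.sum_Ico_consecutive x hj hm.le]; ring
    have keyS : ∀ j ≤ m, ∑ i ∈ Finset.Ico j m, ((sylvester i : ℝ))⁻¹ =
        ((sylvester j : ℝ) - 1)⁻¹ - ((sylvester m : ℝ) - 1)⁻¹ := fun j hj => by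
      rw [Finset.sum_Ico_eq_sub _ hj, sum_inv_sylvester, sum_inv_sylvester]; ring
    have hp := prod_le_prod_of_tail_sum_le (N := m) (x := x)
      (y := fun i => ((sylvester i : ℝ))⁻¹) (fun i hi => h.pos i (hi.trans hm))
      (fun i _ => inv_nonneg.2 (sylvester_pos i).le) (fun i hi => h.anti i (hi.trans hm))
      (fun j hj => by
        rw [key j hj.le, keyS j hj.le]
        linarith [ih j hj (hj.trans hm)])
    rw [prod_inv_sylvester] at hp
    linarith [h.prod_le m hm]

/-- The second smallest coordinate is bounded below. -/
theorem ProductSum.inv_le_second {D : ℕ} {x : ℕ → ℝ} (h : ProductSum (D + 2) x) :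
    (2 * ((sylvester D : ℝ) - 1))⁻¹ ≤ x D := by
  have h1 := h.inv_le_sum D (by omega)
  rw [Finset.sum_Ico_succ_top (by omega), Nat.Ico_succ_singleton, Finset.sum_singleton] at h1
  have h2 := h.anti D (by omega)
  rw [mul_inv]
  linarith

theorem ProductSum.anti_le {n : ℕ} {x : ℕ → ℝ} (h : ProductSum n x) {i j : ℕ} (hij : i ≤ j)
    (hj : j < n) : x j ≤ x i := by
  induction j, hij using Nat.le_induction with
  | base => exact le_rfl
  | succ j hij ih => exact (h.anti j hj).trans (ih (by omega))

theorem min_le_sub_mul_pow (a : ℕ) {q t t₁ t₂ : ℝ} (h0 : 0 < t₁) (h1 : t₁ ≤ t) (h2 : t ≤ t₂)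
    (hq : (a + 1) * t₂ ≤ q) :
    min ((q - (a + 1) * t₁) * t₁ ^ a) ((q - (a + 1) * t₂) * t₂ ^ a) ≤
      (q - (a + 1) * t) * t ^ a := by
  obtain ⟨v, w, hv, hw, hvw, rfl⟩ := (Convex.mem_Icc (h1.trans h2)).1 ⟨h1, h2⟩
  have ht₂ : 0 < t₂ := by linarith
  have hz₂ : 0 ≤ q - (a + 1) * t₂ := by linarith
  have hz₁ : 0 ≤ q - (a + 1) * t₁ := by nlinarith [(Nat.cast_nonneg a : (0 : ℝ) ≤ a)]
  have e : q - (a + 1) * (v * t₁ + w * t₂) =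
      v * (q - (a + 1) * t₁) + w * (q - (a + 1) * t₂) := by
    obtain rfl : w = 1 - v := by linarith
    ring
  set z₁ := q - (a + 1) * t₁
  set z₂ := q - (a + 1) * t₂
  have hM : 0 ≤ min (z₁ * t₁ ^ a) (z₂ * t₂ ^ a) := by positivity
  rw [e]
  calc min (z₁ * t₁ ^ a) (z₂ * t₂ ^ a)
      = min (z₁ * t₁ ^ a) (z₂ * t₂ ^ a) ^ v * min (z₁ * t₁ ^ a) (z₂ * t₂ ^ a) ^ w := by
        rw [← Real.rpow_add_of_nonneg hM hv hw, hvw, Real.rpow_one]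
    _ ≤ (z₁ * t₁ ^ a) ^ v * (z₂ * t₂ ^ a) ^ w := by
        gcongr
        · exact min_le_left _ _
        · exact min_le_right _ _
    _ = (z₁ ^ v * z₂ ^ w) * (t₁ ^ v * t₂ ^ w) ^ a := by
        rw [Real.mul_rpow hz₁ (by positivity), Real.mul_rpow hz₂ (by positivity), mul_pow,
          Real.rpow_pow_comm h0.le, Real.rpow_pow_comm ht₂.le]
        ring
    _ ≤ _ := by
        gcongr
        · exact Real.geom_mean_le_arith_mean2_weighted hv hw hz₁ hz₂ hvw
        · exact Real.geom_mean_le_arith_mean2_weighted hv hw h0.le ht₂.le hvw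

theorem sylvester_step {u : ℝ} (hu : 1 ≤ u) {a : ℕ} (ha : 1 ≤ a) (h : 2 ≤ u ∨ 2 ≤ a) :
    u * (a + 2) ^ (a + 1) ≤ (u + 1) ^ (a + 1) * (a + 1) ^ a := by
  have step : ∀ a : ℕ, 1 ≤ a → u * (a + 2) ^ (a + 1) ≤ (u + 1) ^ (a + 1) * (a + 1) ^ a →
      u * ((a + 1 : ℕ) + 2) ^ ((a + 1) + 1) ≤
        (u + 1) ^ ((a + 1) + 1) * ((a + 1 : ℕ) + 1) ^ (a + 1) := by
    intro a ha ih
    have ha' : (1 : ℝ) ≤ a := by exact_mod_cast ha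
    push_cast
    have h1 : ((a : ℝ) + 1 + 2) ^ (a + 1 + 1) * (a + 1) ^ a ≤
        (u + 1) * ((a + 2) ^ (a + 1) * (a + 1 + 1) ^ (a + 1)) := by
      calc ((a : ℝ) + 1 + 2) ^ (a + 1 + 1) * (a + 1) ^ a
          = ((a + 3) * (a + 1)) ^ a * (a + 3) ^ 2 := by rw [mul_pow]; ring
        _ ≤ ((a + 2) ^ 2) ^ a * ((u + 1) * (a + 2) ^ 2) := by
            gcongr
            · nlinarith
            · nlinarith [sq_nonneg ((a : ℝ) + 2)]
        _ = (u + 1) * ((a + 2) ^ (a + 1) * (a + 1 + 1) ^ (a + 1)) := by rw [← pow_mul]; ring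
    have hpos : (0 : ℝ) < ((a : ℝ) + 2) ^ (a + 1) * (a + 1) ^ a := by positivity
    refine le_of_mul_le_mul_right ?_ hpos
    calc u * ((a : ℝ) + 1 + 2) ^ (a + 1 + 1) * ((a + 2) ^ (a + 1) * (a + 1) ^ a)
        = (u * (a + 2) ^ (a + 1)) * (((a : ℝ) + 1 + 2) ^ (a + 1 + 1) * (a + 1) ^ a) := by ring
      _ ≤ ((u + 1) ^ (a + 1) * (a + 1) ^ a) *
          ((u + 1) * ((a + 2) ^ (a + 1) * (a + 1 + 1) ^ (a + 1))) := by gcongr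
      _ = _ := by ring
  rcases h with h | h
  · induction a, ha using Nat.le_induction with
    | base => norm_num; nlinarith
    | succ a ha ih => exact step a ha ih
  · induction a, h using Nat.le_induction with
    | base => norm_num; nlinarith [sq_nonneg (u - 1), mul_nonneg (sub_nonneg.2 hu) (sq_nonneg (u - 1))]
    | succ a h ih => exact step a (by omega) (ih (by omega))

/-- The product of all but the last coordinate of `(1/s₁, …, 1/sₘ, q/r, …, q/r)`, where there are
`r` equal last coordinates and `q` is chosen such that the sum is `1`. -/
noncomputable def blockProd (m r : ℕ) : ℝ :=
  (((sylvester m : ℝ) - 1) ^ r * (r : ℝ) ^ (r - 1))⁻¹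

theorem blockProd_succ_le {m a : ℕ} (ha : 1 ≤ a) (h : 3 ≤ m + a + 1) :
    blockProd (m + 1) (a + 1) ≤ blockProd m (a + 2) := by
  have h1 := one_le_sylvester_sub_one m
  unfold blockProd
  have key : (sylvester m - 1 : ℝ) * (a + 2) ^ (a + 1) ≤
      ((sylvester m - 1 : ℝ) + 1) ^ (a + 1) * (a + 1) ^ a := by
    refine sylvester_step h1 ha ?_
    rcases Nat.eq_zero_or_pos m with rfl | hm
    · right; omega
    · left
      have h3 : sylvester 1 ≤ sylvester m := sylvester_monotone hm
      have h4 : (3 : ℝ) ≤ sylvester m := by exact_mod_cast h3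
      linarith
  have h0 : 0 < (sylvester m : ℝ) - 1 := by linarith
  refine inv_anti₀ (by positivity) ?_
  rw [sylvester_succ_sub_one]
  have hp : 0 ≤ ((sylvester m : ℝ) - 1) ^ (a + 1) := by positivity
  have := mul_le_mul_of_nonneg_left key hp
  rw [show a + 2 - 1 = a + 1 by omega]
  push_cast [Nat.add_sub_cancel]
  calc _ = ((sylvester m : ℝ) - 1) ^ (a + 1) * ((sylvester m - 1 : ℝ) * (a + 2) ^ (a + 1)) := by ring
    _ ≤ _ := this
    _ = _ := by rw [mul_pow]; ring

theorem blockProd_le {D m : ℕ} (hD : 3 ≤ D) (hm : m + 1 ≤ D) :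
    (2 * ((sylvester (D - 1) : ℝ) - 1) ^ 2)⁻¹ ≤ blockProd m (D + 1 - m) := by
  have hm' : m ≤ D - 1 := by omega
  induction hm' using Nat.decreasingInduction with
  | self =>
    rw [show D + 1 - (D - 1) = 2 by omega, blockProd]
    norm_num [mul_comm]
  | of_succ m hm' ih =>
    refine (ih (by omega)).trans ?_
    obtain ⟨a, rfl⟩ : ∃ a, D = m + a + 1 := ⟨D - m - 1, by omega⟩
    rw [show m + a + 1 + 1 - (m + 1) = a + 1 by omega, show m + a + 1 + 1 - m = a + 2 by omega]
    exact blockProd_succ_le (by omega) (by omega)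

theorem ProductSum.le_prod_of_le {m a : ℕ} {x : ℕ → ℝ} (h : ProductSum (m + a + 2) x)
    (ht : x (m + a + 1) ≤ ((sylvester m : ℝ) - 1)⁻¹ / (a + 2)) :
    ((sylvester m : ℝ) - 1)⁻¹ * ((((sylvester m : ℝ) - 1)⁻¹ - (a + 1) * x (m + a + 1)) *
      x (m + a + 1) ^ a) ≤ ∏ i ∈ Finset.range (m + a + 1), x i := by
  have hpos := h.pos (m + a + 1) (by omega)
  set t := x (m + a + 1) with htdef
  set q := ((sylvester m : ℝ) - 1)⁻¹ with hq
  rw [le_div_iff₀ (by positivity)] at ht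
  let y : ℕ → ℝ := fun i =>
    if i < m then ((sylvester i : ℝ))⁻¹ else if i = m then q - (a + 1) * t else t
  have hy₁ : ∀ i, i < m → y i = ((sylvester i : ℝ))⁻¹ := fun i hi => by simp [y, hi]
  have hy₂ : y m = q - (a + 1) * t := by simp [y]
  have hy₃ : ∀ i, m < i → y i = t := fun i hi => by
    simp [y, hi.not_gt, hi.ne']
  have hprod : ∏ i ∈ Finset.range (m + a + 1), y i = q * ((q - (a + 1) * t) * t ^ a) := by
    rw [show m + a + 1 = m + 1 + a by ring, Finset.prod_range_add, Finset.prod_range_succ, hy₂,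
      Finset.prod_congr rfl fun i hi => hy₁ i (Finset.mem_range.1 hi), prod_inv_sylvester,
      Finset.prod_congr rfl fun i _ => hy₃ (m + 1 + i) (by omega), Finset.prod_const,
      Finset.card_range, mul_assoc]
  rw [← hprod]
  refine prod_le_prod_of_tail_sum_le (fun i hi => h.pos i (by omega)) (fun i _ => ?_)
    (fun i hi => h.anti i (by omega)) (fun j hj => ?_)
  · rcases lt_trichotomy i m with hi | rfl | hi
    · rw [hy₁ i hi]; exact inv_nonneg.2 (sylvester_pos i).le
    · rw [hy₂]; linarith
    · rw [hy₃ i hi]; exact hpos.le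
  · rcases lt_or_ge m j with hmj | hmj
    · refine Finset.sum_le_sum fun i hi => ?_
      rw [Finset.mem_Ico] at hi
      rw [hy₃ i (by omega)]
      exact h.anti_le (by omega) (by omega)
    · have h1 := h.inv_le_sum j (by omega)
      rw [Finset.sum_Ico_succ_top (by omega)] at h1
      have h2 : ∑ i ∈ Finset.Ico j (m + a + 1), y i =
          ((sylvester j : ℝ) - 1)⁻¹ - t := by
        rw [← Finset.sum_Ico_consecutive _ hmj (by omega),
          Finset.sum_eq_sum_Ico_succ_bot (by omega : m < m + a + 1), hy₂,
          Finset.sum_congr rfl fun i hi => hy₁ i (Finset.mem_Ico.1 hi).2,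
          Finset.sum_congr rfl fun i hi => hy₃ i (Finset.mem_Ico.1 hi).1,
          Finset.sum_const, Nat.card_Ico, Finset.sum_Ico_eq_sub _ hmj, sum_inv_sylvester,
          sum_inv_sylvester, show m + a + 1 - (m + 1) = a by omega, nsmul_eq_mul]
        ring
      rw [h2]
      linarith

/-- The product of all but the smallest coordinate is bounded below. -/
theorem ProductSum.le_prod {D : ℕ} (hD : 3 ≤ D) {x : ℕ → ℝ} (h : ProductSum (D + 1) x) :
    (2 * ((sylvester (D - 1) : ℝ) - 1) ^ 2)⁻¹ ≤ ∏ i ∈ Finset.range D, x i := by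
  obtain ⟨m, hmD, hpm, hnp⟩ : ∃ m ≤ D - 1,
      x D ≤ ((sylvester m : ℝ) - 1)⁻¹ / (D + 1 - m : ℕ) ∧
      ∀ k, m < k → k ≤ D - 1 → ((sylvester k : ℝ) - 1)⁻¹ / (D + 1 - k : ℕ) < x D := by
    classical
    let p : ℕ → Prop := fun m => x D ≤ ((sylvester m : ℝ) - 1)⁻¹ / (D + 1 - m : ℕ)
    have hp0 : p 0 := by
      have h1 : ∑ _i ∈ Finset.range (D + 1), x D ≤ ∑ i ∈ Finset.range (D + 1), x i :=
        Finset.sum_le_sum fun i hi => by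
          rw [Finset.mem_range] at hi
          exact h.anti_le (by omega) (by omega)
      rw [h.sum_eq, Finset.sum_const, Finset.card_range, nsmul_eq_mul] at h1
      simp only [p, sylvester, tsub_zero]
      rw [le_div_iff₀ (by positivity)]
      norm_num at h1 ⊢
      linarith
    exact ⟨Nat.findGreatest p (D - 1), Nat.findGreatest_le _,
      Nat.findGreatest_spec (P := p) (Nat.zero_le _) hp0,
      fun k hk hk' => not_le.1 (Nat.findGreatest_is_greatest (P := p) hk hk')⟩
  obtain ⟨a, rfl⟩ : ∃ a, D = m + a + 1 := ⟨D - m - 1, by omega⟩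
  have hq : (0 : ℝ) < ((sylvester m : ℝ) - 1)⁻¹ := by
    have := one_le_sylvester_sub_one m
    positivity
  have hpm' : x (m + a + 1) ≤ ((sylvester m : ℝ) - 1)⁻¹ / (a + 2) := by
    rw [show m + a + 1 + 1 - m = a + 2 by omega] at hpm
    exact_mod_cast hpm
  have hend₂ : ((sylvester m : ℝ) - 1)⁻¹ * ((((sylvester m : ℝ) - 1)⁻¹ -
      (a + 1) * (((sylvester m : ℝ) - 1)⁻¹ / (a + 2))) * (((sylvester m : ℝ) - 1)⁻¹ / (a + 2)) ^ a) =
      blockProd m (a + 2) := by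
    have := one_le_sylvester_sub_one m
    have h0 : (sylvester m : ℝ) - 1 ≠ 0 := by positivity
    rw [blockProd, show a + 2 - 1 = a + 1 by omega, div_pow, inv_pow]
    push_cast
    field_simp
    ring
  refine le_trans ?_ (h.le_prod_of_le hpm')
  have hb₂ := blockProd_le hD (m := m) (by omega)
  rw [show m + a + 1 + 1 - m = a + 2 by omega] at hb₂
  rcases Nat.eq_zero_or_pos a with rfl | ha
  · rw [← hend₂] at hb₂
    refine hb₂.trans ?_
    simp only [pow_zero, mul_one]
    push_cast at hpm' ⊢
    gcongr
  · have hlt : ((sylvester (m + 1) : ℝ) - 1)⁻¹ / (a + 1) ≤ x (m + a + 1) := by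
      have := hnp (m + 1) (by omega) (by omega)
      rw [show m + a + 1 + 1 - (m + 1) = a + 1 by omega] at this
      exact_mod_cast this.le
    have hq' : (0 : ℝ) < ((sylvester (m + 1) : ℝ) - 1)⁻¹ := by
      have := one_le_sylvester_sub_one (m + 1)
      positivity
    have hend₁ : ((sylvester m : ℝ) - 1)⁻¹ * ((((sylvester m : ℝ) - 1)⁻¹ -
        (a + 1) * (((sylvester (m + 1) : ℝ) - 1)⁻¹ / (a + 1))) *
        (((sylvester (m + 1) : ℝ) - 1)⁻¹ / (a + 1)) ^ a) = blockProd (m + 1) (a + 1) := by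
      have := one_le_sylvester_sub_one m
      have h0 : (sylvester m : ℝ) - 1 ≠ 0 := by positivity
      have h1 := (sylvester_pos m).ne'
      rw [blockProd, Nat.add_sub_cancel, sylvester_succ_sub_one, div_pow, inv_pow, mul_pow, mul_pow]
      push_cast
      field_simp
      ring
    have hb₁ := blockProd_le hD (m := m + 1) (by omega)
    rw [show m + a + 1 + 1 - (m + 1) = a + 1 by omega, ← hend₁] at hb₁
    rw [← hend₂] at hb₂
    refine le_trans ?_ (mul_le_mul_of_nonneg_left (min_le_sub_mul_pow a
      (q := ((sylvester m : ℝ) - 1)⁻¹) (div_pos hq' (by positivity)) hlt hpm' ?_) hq.le)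
    · rw [mul_min_of_nonneg _ _ hq.le]
      exact le_min hb₁ hb₂
    · rw [mul_div_assoc', div_le_iff₀ (by positivity)]
      nlinarith

/-- The reciprocal of a lower bound for the product of all but the smallest of `k + 1` numbers
satisfying the product-sum inequalities. -/
noncomputable def prodBound (k : ℕ) : ℝ :=
  if k = 2 then 12 else 2 * ((sylvester (k - 1) : ℝ) - 1) ^ 2

theorem prodBound_pos (k : ℕ) : 0 < prodBound k := by
  have := one_le_sylvester_sub_one (k - 1)
  unfold prodBound
  split_ifs <;> positivity

theorem ProductSum.inv_prodBound_le {D : ℕ} (hD : 1 ≤ D) {x : ℕ → ℝ} (h : ProductSum (D + 1) x) :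
    (prodBound D)⁻¹ ≤ ∏ i ∈ Finset.range D, x i := by
  obtain rfl | rfl | hD : D = 1 ∨ D = 2 ∨ 3 ≤ D := by omega
  · have h1 := h.inv_le_second
    norm_num [prodBound, sylvester] at h1 ⊢
    linarith
  · have h1 := h.inv_le_second
    have h2 := h.sum_eq
    have h3 := h.anti 0 (by omega)
    have h4 := h.anti 1 (by omega)
    norm_num [prodBound, sylvester, Finset.sum_range_succ, Finset.prod_range_succ] at *
    nlinarith
  · rw [prodBound, if_neg (by omega)]
    exact h.le_prod hD

theorem two_mul_add_one_le_sylvester {d : ℕ} (hd : 4 ≤ d) : 2 * (d + 1) ≤ sylvester (d - 1) := by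
  induction d, hd using Nat.le_induction with
  | base => norm_num [sylvester]
  | succ d hd ih =>
    obtain ⟨e, rfl⟩ : ∃ e, d = e + 1 := ⟨d - 1, by omega⟩
    simp only [Nat.add_sub_cancel] at ih ⊢
    have h1 := sylvester_succ_sub_one e
    have h2 : (2 * (e + 1 + 1) : ℝ) ≤ sylvester e := by exact_mod_cast ih
    have h3 : (2 * (e + 1 + 1 + 1) : ℝ) ≤ sylvester (e + 1) := by
      nlinarith [(Nat.cast_nonneg e : (0 : ℝ) ≤ e)]
    exact_mod_cast h3

theorem prodBound_mul_pow_le {k d : ℕ} (hk : 1 ≤ k) (hkd : k ≤ d) (hd : 4 ≤ d) :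
    prodBound k / k.factorial * (2 * ((sylvester (k - 1) : ℝ) - 1)) ^ (d - k) ≤
      2 * ((sylvester (d - 1) : ℝ) - 1) ^ 2 / d.factorial := by
  have step : ∀ d, 4 ≤ d → k ≤ d →
      prodBound k / k.factorial * (2 * ((sylvester (k - 1) : ℝ) - 1)) ^ (d - k) ≤
        2 * ((sylvester (d - 1) : ℝ) - 1) ^ 2 / d.factorial →
      prodBound k / k.factorial * (2 * ((sylvester (k - 1) : ℝ) - 1)) ^ (d + 1 - k) ≤
        2 * ((sylvester (d + 1 - 1) : ℝ) - 1) ^ 2 / (d + 1).factorial := by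
    intro d hd hkd ih
    obtain ⟨e, rfl⟩ : ∃ e, d = e + 1 := ⟨d - 1, by omega⟩
    have h1 := two_mul_add_one_le_sylvester hd
    simp only [Nat.add_sub_cancel] at ih h1 ⊢
    have h1' : (2 * ((e + 1 : ℕ) + 1) : ℝ) ≤ sylvester e := by exact_mod_cast h1
    have h2 : (sylvester (k - 1) : ℝ) ≤ sylvester e := by
      exact_mod_cast sylvester_monotone (by omega)
    have h3 := one_le_sylvester_sub_one (k - 1)
    have h4 := one_le_sylvester_sub_one e
    rw [show e + 1 + 1 - k = (e + 1 - k) + 1 by omega, pow_succ, ← mul_assoc,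
      sylvester_succ_sub_one, Nat.factorial_succ (e + 1)]
    refine (mul_le_mul_of_nonneg_right ih (by linarith)).trans ?_
    have hf : (0 : ℝ) < (e + 1).factorial := by positivity
    have he : (0 : ℝ) < (e + 1 : ℕ) + 1 := by positivity
    rw [Nat.cast_mul, Nat.cast_succ, div_mul_eq_mul_div, div_le_div_iff₀ hf (by positivity)]
    have h5 : 2 * ((sylvester (k - 1) : ℝ) - 1) * ((e + 1 : ℕ) + 1) ≤ (sylvester e : ℝ) ^ 2 := by
      nlinarith
    have := mul_le_mul_of_nonneg_left h5
      (by positivity : 0 ≤ 2 * ((sylvester e : ℝ) - 1) ^ 2 * (e + 1).factorial)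
    linarith
  rcases le_or_gt k 3 with h | h
  · induction d, hd using Nat.le_induction with
    | base =>
      interval_cases k <;> norm_num [prodBound, sylvester, Nat.factorial]
    | succ d hd ih => exact step d hd (by omega) (ih (by omega))
  · induction d, hkd using Nat.le_induction with
    | base => simp [prodBound, show k ≠ 2 by omega]
    | succ d hkd ih => exact step d (by omega) hkd (ih (by omega))

/-- A parallelepiped of large volume contains a nonzero integer point. -/
theorem exists_int_abs_sub_lt {ι : Type*} [Fintype ι] {β : ι → ℝ} (hβ : ∀ i, 0 < β i)
    (hR : 0 < 1 - ∑ i, β i) (h : 1 - ∑ i, β i < ∏ i, β i) :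
    ∃ k : ι → ℤ, k ≠ 0 ∧ ∀ i, |(k i : ℝ) - (∑ j, (k j : ℝ)) * β i| < β i := by
  classical
  let M : Matrix ι ι ℝ := 1 - Matrix.replicateCol Unit β * Matrix.replicateRow Unit (1 : ι → ℝ)
  have hdet : M.det = 1 - ∑ i, β i := by
    simp only [M]
    rw [Matrix.det_one_sub_mul_comm, Matrix.det_unique]
    simp [Matrix.mul_apply]
  have hM : ∀ x i, Matrix.toLin' M x i = x i - (∑ j, x j) * β i := fun x i => by
    simp only [M, Matrix.toLin'_apply, Matrix.sub_mulVec, Matrix.one_mulVec, Pi.sub_apply]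
    congr 1
    simp [Matrix.mulVec, dotProduct, Matrix.mul_apply, Finset.mul_sum, mul_comm]
  let box : Set (ι → ℝ) := Set.pi univ fun i => Ioo (-β i) (β i)
  have hdet' : LinearMap.det (Matrix.toLin' M) = 1 - ∑ i, β i := by
    rw [LinearMap.det_toLin', hdet]
  let b := Pi.basisFun ℝ ι
  have : Countable (Submodule.span ℤ (range b)).toAddSubgroup :=
    inferInstanceAs <| Countable (Submodule.span ℤ (range b))
  have hconv : Convex ℝ box := convex_pi fun i _ => convex_Ioo _ _
  obtain ⟨⟨x, hxL⟩, hx0, hxs⟩ :=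
    exists_ne_zero_mem_lattice_of_measure_mul_two_pow_lt_measure (μ := volume)
      (ZSpan.isAddFundamentalDomain' b volume) (s := Matrix.toLin' M ⁻¹' box)
      (fun x hx i hi => by
        have := hx i hi
        rw [map_neg, Pi.neg_apply]
        exact ⟨neg_lt_neg this.2, by linarith [this.1]⟩)
      (hconv.linear_preimage _)
      (by
        have hv : volume (Matrix.toLin' M ⁻¹' box) =
            ENNReal.ofReal ((1 - ∑ i, β i)⁻¹ * (2 ^ Fintype.card ι * ∏ i, β i)) := by
          rw [Measure.addHaar_preimage_linearMap volume (by rw [hdet']; exact hR.ne'), hdet',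
            abs_of_pos (inv_pos.2 hR), ENNReal.ofReal_mul (inv_pos.2 hR).le]
          congr 1
          simp only [box]
          rw [volume_pi, Measure.pi_pi]
          simp only [Real.volume_Ioo]
          rw [← ENNReal.ofReal_prod_of_nonneg fun i _ => by linarith [hβ i]]
          congr 1
          rw [← Finset.card_univ, ← Finset.prod_const, ← Finset.prod_mul_distrib]
          exact Finset.prod_congr rfl fun i _ => by ring
        rw [hv, ZSpan.fundamentalDomain_pi_basisFun, volume_pi, Measure.pi_pi]
        simp only [Real.volume_Ico, sub_zero, ENNReal.ofReal_one, Finset.prod_const_one, one_mul,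
          Module.finrank_fintype_fun_eq_card]
        rw [← ENNReal.ofReal_ofNat 2, ← ENNReal.ofReal_pow (by norm_num),
          ENNReal.ofReal_lt_ofReal_iff_of_nonneg (by positivity), inv_mul_eq_div, lt_div_iff₀ hR]
        exact mul_lt_mul_of_pos_left h (by positivity))
  have hx : ∀ i, ∃ z : ℤ, (z : ℝ) = x i := (b.mem_span_iff_repr_mem ℤ x).1 hxL
  choose k hk using hx
  refine ⟨k, ?_, fun i => ?_⟩
  · rintro rfl
    apply hx0
    ext i
    simp [← hk i]
  · have := hxs i (mem_univ i)
    rw [hM] at this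
    simp only [hk]
    exact abs_lt.2 this

theorem volume_corner_simplex_le (n : ℕ) {t : ℝ} (ht : 0 ≤ t) :
    volume {z : Fin n → ℝ | (∀ i, 0 ≤ z i) ∧ ∑ i, z i ≤ t} ≤
      ENNReal.ofReal (t ^ n / n.factorial) := by
  induction n generalizing t with
  | zero =>
    refine (measure_mono (subset_univ _)).trans ?_
    simp [volume_pi]
  | succ n ih =>
    have e := (volume_preserving_piFinSuccAbove (fun _ : Fin (n + 1) => ℝ) 0).symm
    have hms : MeasurableSet {z : Fin (n + 1) → ℝ | (∀ i, 0 ≤ z i) ∧ ∑ i, z i ≤ t} := by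
      measurability
    rw [← e.measure_preimage hms.nullMeasurableSet, Measure.volume_eq_prod,
      Measure.prod_apply (e.measurable hms)]
    calc _ ≤ ∫⁻ a in Icc 0 t, ENNReal.ofReal ((t - a) ^ n / n.factorial) := by
          rw [← lintegral_indicator measurableSet_Icc]
          refine lintegral_mono fun a => ?_
          by_cases ha : a ∈ Icc 0 t
          · rw [indicator_of_mem ha]
            refine le_trans (measure_mono ?_) (ih (sub_nonneg.2 ha.2))
            rintro z ⟨h1, h2⟩
            refine ⟨fun i => ?_, ?_⟩
            · simpa using h1 i.succ
            · simp [Fin.sum_univ_succ] at h2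
              linarith
          · rw [indicator_of_notMem ha, nonpos_iff_eq_zero]
            refine measure_mono_null (t := ∅) ?_ measure_empty
            rintro z ⟨h1, h2⟩
            apply ha
            have h3 : 0 ≤ a := by simpa using h1 0
            have h4 : ∀ i, 0 ≤ z i := fun i => by simpa using h1 i.succ
            simp [Fin.sum_univ_succ] at h2
            exact ⟨h3, by linarith [Finset.sum_nonneg fun i (_ : i ∈ Finset.univ) => h4 i]⟩
      _ = ENNReal.ofReal (∫ a in Icc 0 t, (t - a) ^ n / n.factorial) := by
          rw [ofReal_integral_eq_lintegral_ofReal]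
          · exact Continuous.integrableOn_Icc (by fun_prop)
          · refine (ae_restrict_iff' measurableSet_Icc).2 (ae_of_all _ fun a ha => ?_)
            have := sub_nonneg.2 ha.2
            positivity
      _ ≤ _ := by
          apply ENNReal.ofReal_le_ofReal
          rw [integral_Icc_eq_integral_Ioc, ← intervalIntegral.integral_of_le ht,
            intervalIntegral.integral_div, intervalIntegral.integral_comp_sub_left (fun x => x ^ n),
            integral_pow, Nat.factorial_succ]
          apply le_of_eq
          push_cast
          simp
          field_simp

/-- The product of a corner simplex and a cube. -/
theorem volume_simplex_prod_cube_le (k : ℕ) (κ : Type*) [Fintype κ] :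
    volume {z : Fin k ⊕ κ → ℝ | (∀ i, 0 ≤ z i) ∧ ∑ i, z (Sum.inl i) ≤ 1 ∧
      ∀ j, z (Sum.inr j) ≤ 1} ≤ ENNReal.ofReal (1 / k.factorial) := by
  have e := volume_measurePreserving_sumPiEquivProdPi (fun _ : Fin k ⊕ κ => ℝ)
  set A := {z : Fin k → ℝ | (∀ i, 0 ≤ z i) ∧ ∑ i, z i ≤ 1}
  set B : Set (κ → ℝ) := Icc 0 1
  have hA : MeasurableSet A := by measurability
  have hB : MeasurableSet B := measurableSet_Icc
  calc _ ≤ volume ((MeasurableEquiv.sumPiEquivProdPi fun _ : Fin k ⊕ κ => ℝ) ⁻¹' (A ×ˢ B)) := by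
        refine measure_mono ?_
        rintro z ⟨h1, h2, h3⟩
        exact ⟨⟨fun i => h1 (Sum.inl i), h2⟩, fun i => h1 (Sum.inr i), h3⟩
    _ = volume A * volume B := by
        rw [e.measure_preimage (hA.prod hB).nullMeasurableSet, Measure.volume_eq_prod,
          Measure.prod_prod]
    _ ≤ _ := by
        have h1 := volume_corner_simplex_le k zero_le_one
        rw [one_pow] at h1
        have h2 : volume B = 1 := by simp [B, Real.volume_Icc_pi]
        rw [h2, mul_one]
        exact h1

theorem Finset.exists_minimal_dependency {E : Type*} [AddCommGroup E] [Module ℝ E]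
    {V : Finset E} {w : E} (hwV : w ∈ V) {c : E → ℝ} (hc : ∀ x ∈ V, 0 ≤ c x) (hw : 0 < c w)
    (hsum : ∑ x ∈ V, c x • x = 0) :
    ∃ S ⊆ V, w ∈ S ∧ ∃ c : E → ℝ, (∀ x ∈ S, 0 < c x) ∧ ∑ x ∈ S, c x • x = 0 ∧
      ∀ e : E → ℝ, ∑ x ∈ S, e x • x = 0 → ∃ t, ∀ x ∈ S, e x = t * c x := by
  classical
  let Q : Finset E → Prop := fun S =>
    w ∈ S ∧ ∃ c : E → ℝ, (∀ x ∈ S, 0 < c x) ∧ ∑ x ∈ S, c x • x = 0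
  have key : ∀ (S : Finset E) (c : E → ℝ), w ∈ S → (∀ x ∈ S, 0 ≤ c x) → 0 < c w →
      ∑ x ∈ S, c x • x = 0 → Q (S.filter fun x => 0 < c x) := fun S c h1 h2 h3 h4 => by
    refine ⟨by simp [h1, h3], c, fun x hx => (Finset.mem_filter.1 hx).2, ?_⟩
    rw [← h4]
    refine Finset.sum_filter_of_ne fun x hx hne => (h2 x hx).lt_of_ne fun h => hne ?_
    rw [← h, zero_smul]
  obtain ⟨S, hS, hmin⟩ := Finset.exists_min_image (V.powerset.filter Q) Finset.card
    ⟨_, Finset.mem_filter.2 ⟨Finset.mem_powerset.2 (Finset.filter_subset _ _),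
      key V c hwV hc hw hsum⟩⟩
  obtain ⟨hSV, hwS, c, hc, hsum⟩ := Finset.mem_filter.1 hS
  rw [Finset.mem_powerset] at hSV
  refine ⟨S, hSV, hwS, c, hc, hsum, fun e he => ?_⟩
  have nonpos : ∀ f : E → ℝ, f w = 0 → ∑ x ∈ S, f x • x = 0 → ∀ x ∈ S, f x ≤ 0 := by
    intro f hfw hf
    by_contra! hcon
    obtain ⟨y, hyS, hy⟩ := hcon
    obtain ⟨x₀, hx₀, hle⟩ := Finset.exists_min_image (S.filter fun x => 0 < f x)
      (fun x => c x / f x) ⟨y, Finset.mem_filter.2 ⟨hyS, hy⟩⟩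
    obtain ⟨hx₀S, hx₀⟩ := Finset.mem_filter.1 hx₀
    set t := c x₀ / f x₀ with ht
    have ht0 : 0 < t := div_pos (hc _ hx₀S) hx₀
    have h2 : ∀ x ∈ S, 0 ≤ c x - t * f x := fun x hx => by
      rcases le_or_gt (f x) 0 with h | h
      · nlinarith [hc x hx]
      · have := hle x (Finset.mem_filter.2 ⟨hx, h⟩)
        rw [le_div_iff₀ h] at this
        linarith
    have hQ := key S (fun x => c x - t * f x) hwS h2 (by simpa [hfw] using hc w hwS) (by
      simp only [sub_smul, mul_smul, Finset.sum_sub_distrib, ← Finset.smul_sum, hf, hsum]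
      simp)
    have hcard := hmin _ (Finset.mem_filter.2
      ⟨Finset.mem_powerset.2 ((Finset.filter_subset _ _).trans hSV), hQ⟩)
    refine hcard.not_gt (Finset.card_lt_card (Finset.filter_ssubset.2 ⟨x₀, hx₀S, ?_⟩))
    rw [ht, div_mul_cancel₀ _ hx₀.ne']
    simp
  have hcw := (hc w hwS).ne'
  have hz : ∑ x ∈ S, (e x - e w / c w * c x) • x = 0 := by
    simp only [sub_smul, mul_smul, Finset.sum_sub_distrib, ← Finset.smul_sum, he, hsum]
    simp
  refine ⟨e w / c w, fun x hx => ?_⟩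
  have h1 := nonpos (fun x => e x - e w / c w * c x) (by field_simp; simp) hz x hx
  have h2 := nonpos (fun x => -(e x - e w / c w * c x)) (by field_simp; simp)
    (by simp only [neg_smul, Finset.sum_neg_distrib, hz, neg_zero]) x hx
  linarith

theorem exists_nonneg_dependency {E : Type*} [AddCommGroup E] [Module ℝ E] [TopologicalSpace E]
    [IsTopologicalAddGroup E] [ContinuousSMul ℝ E] {V : Finset E}
    (h0 : (0 : E) ∈ interior (convexHull ℝ (V : Set E))) {w : E} (hwV : w ∈ V) :
    ∃ c : E → ℝ, (∀ x ∈ V, 0 ≤ c x) ∧ 0 < c w ∧ ∑ x ∈ V, c x • x = 0 := by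
  classical
  have hcont : Filter.Tendsto (fun ε : ℝ => -(ε • w)) (nhdsWithin 0 (Ioi 0)) (nhds 0) := by
    have : Continuous fun ε : ℝ => -(ε • w) := by fun_prop
    have := (this.tendsto 0).mono_left (nhdsWithin_le_nhds (s := Ioi 0))
    simpa using this
  obtain ⟨ε, hε, hε0⟩ := ((hcont.eventually (mem_interior_iff_mem_nhds.1 h0)).and
    self_mem_nhdsWithin).exists
  obtain ⟨a, ha, -, hsum⟩ := Finset.mem_convexHull'.1 hε
  have hε0 : 0 < ε := hε0
  refine ⟨fun x => a x + if x = w then ε else 0, fun x hx => ?_, ?_, ?_⟩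
  · have := ha x hx
    dsimp only
    split_ifs <;> linarith
  · have := ha w hwV
    simp only [if_true]
    linarith
  · simp [add_smul, Finset.sum_add_distrib, hsum, ite_smul, hwV]

/-- A minimal positive dependency among `D + 1` lattice points of `P`, normalised and listed by
decreasing coefficients. -/
structure Circuit {d : ℕ} (P : Set (Fin d → ℝ)) (D : ℕ) (v : ℕ → Fin d → ℝ) (β : ℕ → ℝ) :
    Prop where
  lattice : ∀ i ≤ D, IsLatticePt (v i)
  mem : ∀ i ≤ D, v i ∈ P
  pos : ∀ i ≤ D, 0 < β i
  anti : ∀ i, i + 1 ≤ D → β (i + 1) ≤ β i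
  sum_eq : ∑ i ∈ Finset.range (D + 1), β i = 1
  sum_smul : ∑ i ∈ Finset.range (D + 1), β i • v i = 0
  unique : ∀ c : ℕ → ℝ, ∑ i ∈ Finset.range (D + 1), c i • v i = 0 →
    ∃ t, ∀ i ≤ D, c i = t * β i

theorem exists_circuit {d : ℕ} {V : Finset (Fin d → ℝ)} (hV : ∀ v ∈ V, IsLatticePt v)
    (h0 : 0 ∈ interior (convexHull ℝ (V : Set (Fin d → ℝ)))) {w : Fin d → ℝ} (hw : w ∈ V) :
    ∃ D v β, Circuit (convexHull ℝ (V : Set (Fin d → ℝ))) D v β ∧ ∃ i ≤ D, v i = w := by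
  obtain ⟨c, hc, hcw, hsum⟩ := exists_nonneg_dependency h0 hw
  obtain ⟨S, hSV, hwS, c, hc, hsum, huniq⟩ := Finset.exists_minimal_dependency hw hc hcw hsum
  obtain ⟨D, hD⟩ : ∃ D, S.card = D + 1 :=
    Nat.exists_eq_succ_of_ne_zero (Finset.card_ne_zero_of_mem hwS)
  set T := ∑ x ∈ S, c x with hT
  have hTpos : 0 < T := Finset.sum_pos hc ⟨w, hwS⟩
  let e₀ : Fin (D + 1) ≃ S := (S.equivFinOfCardEq hD).symm
  let σ := Tuple.sort fun i => -c (e₀ i)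
  let e : Fin (D + 1) ≃ S := σ.trans e₀
  have hmono : Monotone fun i => -c (e i) := Tuple.monotone_sort fun i => -c (e₀ i)
  have hsumS : ∀ {M : Type} [AddCommMonoid M] (f : (Fin d → ℝ) → M),
      ∑ i, f (e i) = ∑ x ∈ S, f x := fun f => by
    rw [Equiv.sum_comp e (fun x : S => f x), Finset.sum_coe_sort]
  let v : ℕ → Fin d → ℝ := fun i => if h : i < D + 1 then (e ⟨i, h⟩ : Fin d → ℝ) else 0
  have hvF : ∀ i : Fin (D + 1), v i = e i := fun i => by
    simp only [v, i.2, dif_pos]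
  have hv : ∀ i ≤ D, v i ∈ S := fun i hi => by
    have : i < D + 1 := by omega
    simp only [v, this, dif_pos]
    exact (e ⟨i, this⟩).2
  have hinv : ∀ x ∈ S, ∃ i ≤ D, v i = x := fun x hx =>
    ⟨(e.symm ⟨x, hx⟩ : ℕ), by omega, by rw [hvF]; simp⟩
  refine ⟨D, v, fun i => c (v i) / T, ⟨fun i hi => hV _ (hSV (hv i hi)),
    fun i hi => subset_convexHull _ _ (hSV (hv i hi)), fun i hi => div_pos (hc _ (hv i hi)) hTpos,
    fun i hi => ?_, ?_, ?_, fun a ha => ?_⟩, hinv w hwS⟩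
  · have h := @hmono ⟨i, by omega⟩ ⟨i + 1, by omega⟩ (by simp)
    have h1 := hvF ⟨i, by omega⟩
    have h2 := hvF ⟨i + 1, by omega⟩
    simp only at h h1 h2
    rw [← h1, ← h2] at h
    gcongr
    linarith
  · rw [Finset.sum_range]
    simp only [hvF]
    rw [hsumS fun x => c x / T, ← Finset.sum_div, div_self hTpos.ne']
  · rw [Finset.sum_range]
    simp only [hvF]
    rw [hsumS fun x => (c x / T) • x]
    simp only [div_eq_inv_mul, mul_smul, ← Finset.smul_sum, hsum, smul_zero]
  · rw [Finset.sum_range] at ha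
    simp only [hvF] at ha
    let f : (Fin d → ℝ) → ℝ := fun x => if h : x ∈ S then a (e.symm ⟨x, h⟩) else 0
    have hf : ∀ i : Fin (D + 1), f (e i) = a i := fun i => by simp [f]
    obtain ⟨t, ht⟩ := huniq f (by
      rw [← hsumS fun x => f x • x, ← ha]
      exact Finset.sum_congr rfl fun i _ => by rw [hf])
    refine ⟨t * T, fun i hi => ?_⟩
    have h := ht _ (hv i hi)
    have h1 : f (v i) = a i := by
      have := hf ⟨i, by omega⟩
      rwa [← hvF] at this
    rw [← h1, h]
    field_simp

theorem isLatticePt_sum {d : ℕ} {ι : Type*} (s : Finset ι) (k : ι → ℤ) {v : ι → Fin d → ℝ}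
    (hv : ∀ i ∈ s, IsLatticePt (v i)) : IsLatticePt (∑ i ∈ s, (k i : ℝ) • v i) := by
  intro j
  have h : ∀ i ∈ s, ∃ z : ℤ, v i j = z := fun i hi => hv i hi j
  choose! z hz using h
  refine ⟨∑ i ∈ s, k i * z i, ?_⟩
  rw [Finset.sum_apply]
  push_cast
  exact Finset.sum_congr rfl fun i hi => by rw [Pi.smul_apply, smul_eq_mul, hz i hi]

/-- If the origin is interior and has positive barycentric coordinates, then every point with
positive barycentric coordinates is interior. -/
theorem Convex.sum_smul_mem_interior {E ι : Type*} [AddCommGroup E] [Module ℝ E]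
    [TopologicalSpace E] [IsTopologicalAddGroup E] [ContinuousConstSMul ℝ E] {P : Set E}
    (hP : Convex ℝ P) (h0 : 0 ∈ interior P) {s : Finset ι} {v : ι → E} (hv : ∀ i ∈ s, v i ∈ P)
    {β γ : ι → ℝ} (hβ : ∑ i ∈ s, β i = 1) (hβv : ∑ i ∈ s, β i • v i = 0)
    (hγ : ∀ i ∈ s, 0 < γ i) (hγ1 : ∑ i ∈ s, γ i = 1) : ∑ i ∈ s, γ i • v i ∈ interior P := by
  have hev : ∀ᶠ ε in nhdsWithin (0 : ℝ) (Ioi 0), ∀ i ∈ s, ε * β i < γ i := by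
    rw [Filter.eventually_all_finset]
    intro i hi
    have hc : Continuous fun ε : ℝ => ε * β i := by fun_prop
    have := (hc.tendsto 0).mono_left (nhdsWithin_le_nhds (s := Ioi 0))
    rw [zero_mul] at this
    exact this.eventually_lt_const (hγ i hi)
  obtain ⟨ε, hε, hε0, hε1⟩ := (hev.and (Ioo_mem_nhdsGT (zero_lt_one' ℝ))).exists
  have h1 : 0 < 1 - ε := by linarith
  have hy : ∑ i ∈ s, ((γ i - ε * β i) / (1 - ε)) • v i ∈ P := by
    refine hP.sum_mem (fun i hi => ?_) ?_ hv
    · have := hε i hi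
      exact div_nonneg (by linarith) h1.le
    · rw [← Finset.sum_div, Finset.sum_sub_distrib, ← Finset.mul_sum, hβ, hγ1, mul_one,
        div_self h1.ne']
  have := hP.combo_interior_self_mem_interior h0 hy hε0 h1.le (by ring)
  rw [smul_zero, zero_add, Finset.smul_sum] at this
  convert this using 1
  simp only [smul_smul, mul_div_cancel₀ _ h1.ne', sub_smul, Finset.sum_sub_distrib]
  simp only [mul_smul]
  simp only [← Finset.smul_sum, hβv, smul_zero, sub_zero]

theorem Circuit.productSum {d : ℕ} {P : Set (Fin d → ℝ)} {D : ℕ} {v : ℕ → Fin d → ℝ} {β : ℕ → ℝ}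
    (h : Circuit P D v β) (hP : Convex ℝ P) (hint : {x ∈ interior P | IsLatticePt x} = {0}) :
    ProductSum (D + 1) β := by
  refine ⟨fun i hi => h.pos i (by omega), fun i hi => h.anti i (by omega), h.sum_eq,
    fun m hm => ?_⟩
  by_contra! hlt
  have h0 : (0 : Fin d → ℝ) ∈ interior P := by
    have : (0 : Fin d → ℝ) ∈ {x ∈ interior P | IsLatticePt x} := by rw [hint]; rfl
    exact this.1
  have hsplit := Finset.sum_range_add_sum_Ico β hm.le
  rw [h.sum_eq] at hsplit
  have htail : 0 < ∑ i ∈ Finset.Ico m (D + 1), β i :=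
    Finset.sum_pos (fun i hi => h.pos i (by have := Finset.mem_Ico.1 hi; omega))
      ⟨m, Finset.mem_Ico.2 ⟨le_rfl, hm⟩⟩
  have hR : 1 - ∑ i : Fin m, β i = ∑ i ∈ Finset.Ico m (D + 1), β i := by
    rw [← Finset.sum_range]; linarith
  obtain ⟨k, hk, hkβ⟩ := exists_int_abs_sub_lt (β := fun i : Fin m => β i)
    (fun i => h.pos i (by omega)) (by rw [hR]; exact htail)
    (by rw [hR, ← Finset.prod_range]; exact hlt)
  obtain ⟨k, hk, hkβ, hK⟩ : ∃ k : Fin m → ℤ, k ≠ 0 ∧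
      (∀ i, |(k i : ℝ) - (∑ j, (k j : ℝ)) * β i| < β i) ∧ 0 ≤ ∑ j, (k j : ℝ) := by
    rcases le_total 0 (∑ j, (k j : ℝ)) with hK | hK
    · exact ⟨k, hk, hkβ, hK⟩
    · refine ⟨-k, neg_ne_zero.2 hk, fun i => ?_, ?_⟩
      · rw [← abs_neg]
        convert hkβ i using 2
        simp
        ring
      · simpa using hK
  set K := ∑ j, (k j : ℝ) with hKdef
  let l : ℕ → ℤ := fun i => if hi : i < m then k ⟨i, hi⟩ else 0
  have hlF : ∀ i : Fin m, l i = k i := fun i => by simp [l]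
  have hl0 : ∀ i, m ≤ i → l i = 0 := fun i hi => by simp [l, hi]
  have hlsum : ∑ i ∈ Finset.range (D + 1), (l i : ℝ) = K := by
    rw [← Finset.sum_range_add_sum_Ico _ hm.le, Finset.sum_range,
      Finset.sum_eq_zero (s := Finset.Ico _ _)
        fun i hi => by rw [hl0 i (Finset.mem_Ico.1 hi).1, Int.cast_zero], add_zero]
    simp only [hlF, hKdef]
  have hγ : ∀ i ∈ Finset.range (D + 1), 0 < (1 + K) * β i - l i := fun i hi => by
    have hβ := h.pos i (by have := Finset.mem_range.1 hi; omega)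
    rcases lt_or_ge i m with him | him
    · have h1 := (abs_lt.1 (hkβ ⟨i, him⟩)).2
      have h2 := hlF ⟨i, him⟩
      simp only at h1 h2
      rw [← h2] at h1
      linarith
    · rw [hl0 i him, Int.cast_zero, sub_zero]
      positivity
  have hγ1 : ∑ i ∈ Finset.range (D + 1), ((1 + K) * β i - l i) = 1 := by
    rw [Finset.sum_sub_distrib, ← Finset.mul_sum, h.sum_eq, hlsum]
    ring
  have hmem := hP.sum_smul_mem_interior h0
    (fun i hi => h.mem i (by have := Finset.mem_range.1 hi; omega)) h.sum_eq h.sum_smul hγ hγ1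
  have heq : ∑ i ∈ Finset.range (D + 1), ((1 + K) * β i - l i) • v i =
      ∑ i ∈ Finset.range (D + 1), ((-l i : ℤ) : ℝ) • v i := by
    simp only [sub_smul, mul_smul, Finset.sum_sub_distrib, ← Finset.smul_sum, h.sum_smul]
    simp
  have hlat : IsLatticePt (∑ i ∈ Finset.range (D + 1), ((1 + K) * β i - l i) • v i) := by
    rw [heq]
    exact isLatticePt_sum _ (fun i => -l i)
      fun i hi => h.lattice i (by have := Finset.mem_range.1 hi; omega)
  have hz : ∑ i ∈ Finset.range (D + 1), ((1 + K) * β i - l i) • v i = 0 := by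
    have : ∑ i ∈ Finset.range (D + 1), ((1 + K) * β i - l i) • v i ∈
        {x ∈ interior P | IsLatticePt x} := ⟨hmem, hlat⟩
    rwa [hint] at this
  rw [heq] at hz
  obtain ⟨t, ht⟩ := h.unique _ hz
  have ht0 : t = 0 := by
    have h1 := ht D le_rfl
    rw [hl0 D (by omega)] at h1
    simpa [(h.pos D le_rfl).ne'] using h1.symm
  refine hk (funext fun i => ?_)
  have h1 := ht i (by omega)
  rw [ht0, zero_mul, hlF] at h1
  simpa using h1

theorem one_le_abs_det_of_isLatticePt {d : ℕ} (A : Matrix (Fin d) (Fin d) ℝ)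
    (hA : ∀ i, IsLatticePt (A i)) (hli : LinearIndependent ℝ A.row) : 1 ≤ |A.det| := by
  choose B hB using hA
  have hAB : A = (Matrix.of B).map (Int.castRingHom ℝ) := by
    ext i j
    exact hB i j
  have hdet : A.det = ((Matrix.of B).det : ℝ) := by
    rw [hAB, ← RingHom.mapMatrix_apply, ← RingHom.map_det]
    rfl
  have hne : A.det ≠ 0 := by
    rw [Matrix.linearIndependent_rows_iff_isUnit, Matrix.isUnit_iff_isUnit_det] at hli
    exact hli.ne_zero
  rw [hdet] at hne ⊢
  exact_mod_cast Int.one_le_abs (by exact_mod_cast hne)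

/-- A polar dual cut out by a weighted simplex in some coordinates and by slabs in the others. -/
theorem volume_polarDual_le {d k : ℕ} {κ : Type*} [Fintype κ] {P : Set (Fin d → ℝ)}
    {u : Fin k ⊕ κ → Fin d → ℝ} (hd : k + Fintype.card κ = d) (hlat : ∀ s, IsLatticePt (u s))
    (hmem : ∀ s, u s ∈ P) (hli : LinearIndependent ℝ u) {β : Fin k → ℝ} (hβ : ∀ i, 0 < β i)
    {C : ℝ} (hC : 0 < C)
    (hsum : ∀ y ∈ polarDual P, ∑ i, β i * (1 + dotProduct y (u (Sum.inl i))) ≤ 1)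
    (hslab : ∀ y ∈ polarDual P, ∀ j, 1 + dotProduct y (u (Sum.inr j)) ≤ C) :
    volume (polarDual P) ≤
      ENNReal.ofReal ((∏ i, β i)⁻¹ / k.factorial * C ^ Fintype.card κ) := by
  classical
  let e : Fin d ≃ Fin k ⊕ κ := Fintype.equivOfCardEq (by simp [hd])
  let A : Matrix (Fin d) (Fin d) ℝ := Matrix.of fun i => u (e i)
  have hA : 1 ≤ |A.det| :=
    one_le_abs_det_of_isLatticePt A (fun i => hlat _) (hli.comp e e.injective)
  let w : Fin k ⊕ κ → ℝ := Sum.elim β fun _ => C⁻¹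
  have hw : ∀ s, 0 < w s := by rintro (i | j) <;> simp [w, hβ, hC]
  let M : Matrix (Fin d) (Fin d) ℝ := Matrix.diagonal (w ∘ e) * A
  have hM : ∀ y i, Matrix.toLin' M y i = w (e i) * dotProduct y (u (e i)) := fun y i => by
    simp only [M, Matrix.toLin'_apply, ← Matrix.mulVec_mulVec, Matrix.mulVec_diagonal]
    rw [dotProduct_comm]
    rfl
  set W := ∏ i, w (e i) with hWdef
  have hW : W = (∏ i, β i) * (C ^ Fintype.card κ)⁻¹ := by
    rw [hWdef, Equiv.prod_comp e w, Fintype.prod_sum_type]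
    simp [w]
  have hWpos : 0 < W := Finset.prod_pos fun i _ => hw _
  have hdet : LinearMap.det (Matrix.toLin' M) = W * A.det := by
    rw [LinearMap.det_toLin', Matrix.det_mul, Matrix.det_diagonal]
    rfl
  have hdet1 : W ≤ |LinearMap.det (Matrix.toLin' M)| := by
    rw [hdet, abs_mul, abs_of_pos hWpos]
    exact le_mul_of_one_le_right hWpos.le hA
  have hdet0 : LinearMap.det (Matrix.toLin' M) ≠ 0 := abs_pos.1 (hWpos.trans_le hdet1)
  set T := {z : Fin k ⊕ κ → ℝ | (∀ i, 0 ≤ z i) ∧ ∑ i, z (Sum.inl i) ≤ 1 ∧ ∀ j, z (Sum.inr j) ≤ 1}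
  let ψ := MeasurableEquiv.piCongrLeft (fun _ : Fin k ⊕ κ => ℝ) e
  have hψ : ∀ z i, ψ z (e i) = z i := fun z i =>
    Equiv.piCongrLeft_apply_apply (fun _ : Fin k ⊕ κ => ℝ) e z i
  have hsub : polarDual P ⊆ Matrix.toLin' M ⁻¹' (ψ ⁻¹' ((fun z => z + w) ⁻¹' T)) := fun y hy => by
    have hval : ∀ s, (ψ (Matrix.toLin' M y) + w) s = w s * (1 + dotProduct y (u s)) := fun s => by
      obtain ⟨i, rfl⟩ := e.surjective s
      rw [Pi.add_apply, hψ, hM]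
      ring
    refine ⟨fun s => ?_, ?_, fun j => ?_⟩
    · refine le_of_le_of_eq ?_ (hval s).symm
      have : -1 ≤ dotProduct y (u s) := hy _ (hmem s)
      exact mul_nonneg (hw s).le (by linarith)
    · simp only [hval]
      exact hsum y hy
    · exact (hval _).trans_le ((inv_mul_le_one₀ hC).2 (hslab y hy j))
  calc volume (polarDual P)
      ≤ volume (Matrix.toLin' M ⁻¹' (ψ ⁻¹' ((fun z => z + w) ⁻¹' T))) := measure_mono hsub
    _ = ENNReal.ofReal |(LinearMap.det (Matrix.toLin' M))⁻¹| * volume T := by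
      rw [Measure.addHaar_preimage_linearMap volume hdet0,
        (volume_measurePreserving_piCongrLeft (fun _ : Fin k ⊕ κ => ℝ) e).measure_preimage_equiv,
        measure_preimage_add_right]
    _ ≤ ENNReal.ofReal W⁻¹ * ENNReal.ofReal (1 / k.factorial) := by
      gcongr
      · rw [abs_inv]
        exact inv_anti₀ hWpos hdet1
      · exact volume_simplex_prod_cube_le k κ
    _ = _ := by
      rw [← ENNReal.ofReal_mul (inv_nonneg.2 hWpos.le), hW, mul_inv, inv_inv]
      congr 1
      ring

namespace Circuit

variable {d : ℕ} {P : Set (Fin d → ℝ)} {D : ℕ} {v : ℕ → Fin d → ℝ} {β : ℕ → ℝ}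

theorem linearIndependent (h : Circuit P D v β) :
    LinearIndependent ℝ fun i : Fin D => v i := by
  rw [Fintype.linearIndependent_iff]
  intro g hg
  let c : ℕ → ℝ := fun i => if hi : i < D then g ⟨i, hi⟩ else 0
  have hc : ∀ i : Fin D, c i = g i := fun i => by simp [c]
  have hcD : c D = 0 := by simp [c]
  obtain ⟨t, ht⟩ := h.unique c (by
    rw [Finset.sum_range_succ, hcD, zero_smul, add_zero, Finset.sum_range]
    simpa only [hc] using hg)
  have ht0 : t = 0 := by
    have := ht D le_rfl
    rw [hcD] at this
    simpa [(h.pos D le_rfl).ne'] using this.symm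
  intro i
  rw [← hc, ht i i.2.le, ht0, zero_mul]

theorem le_dim (h : Circuit P D v β) : D ≤ d := by
  simpa using h.linearIndependent.fintype_card_le_finrank

theorem one_add_nonneg (h : Circuit P D v β) {y : Fin d → ℝ} (hy : y ∈ polarDual P) {i : ℕ}
    (hi : i ≤ D) : 0 ≤ β i * (1 + dotProduct y (v i)) := by
  have : -1 ≤ dotProduct y (v i) := hy _ (h.mem i hi)
  exact mul_nonneg (h.pos i hi).le (by linarith)

theorem sum_mul_one_add (h : Circuit P D v β) (y : Fin d → ℝ) :
    ∑ i ∈ Finset.range (D + 1), β i * (1 + dotProduct y (v i)) = 1 := by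
  have h1 : dotProduct y (∑ i ∈ Finset.range (D + 1), β i • v i) = 0 := by
    rw [h.sum_smul, dotProduct_zero]
  simp only [dotProduct_sum, dotProduct_smul, smul_eq_mul] at h1
  simp only [mul_add, mul_one, Finset.sum_add_distrib, h.sum_eq, h1, add_zero]

theorem sum_mul_one_add_le (h : Circuit P D v β) {y : Fin d → ℝ} (hy : y ∈ polarDual P) :
    ∑ i : Fin D, β i * (1 + dotProduct y (v i)) ≤ 1 := by
  have h1 := h.sum_mul_one_add y
  rw [Finset.sum_range_succ, Finset.sum_range] at h1
  linarith [h.one_add_nonneg hy le_rfl]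

theorem mul_one_add_le (h : Circuit P D v β) {y : Fin d → ℝ} (hy : y ∈ polarDual P) {i : ℕ}
    (hi : i ≤ D) : β i * (1 + dotProduct y (v i)) ≤ 1 := by
  have h1 := Finset.single_le_sum (f := fun i => β i * (1 + dotProduct y (v i)))
    (s := Finset.range (D + 1))
    (fun j hj => h.one_add_nonneg hy (by have := Finset.mem_range.1 hj; omega))
    (Finset.mem_range.2 (Nat.lt_succ_of_le hi))
  rwa [h.sum_mul_one_add y] at h1

theorem one_add_le (h : Circuit P D v β) (hβ : ProductSum (D + 1) β) {y : Fin d → ℝ}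
    (hy : y ∈ polarDual P) {i : ℕ} (hi : i < D) :
    1 + dotProduct y (v i) ≤ 2 * ((sylvester (D - 1) : ℝ) - 1) := by
  obtain ⟨E, rfl⟩ : ∃ E, D = E + 1 := ⟨D - 1, by omega⟩
  have h1 := hβ.inv_le_second.trans (hβ.anti_le (show i ≤ E by omega) (by omega))
  have h2 := h.mul_one_add_le hy hi.le
  have h3 := one_le_sylvester_sub_one E
  have h4 : (β i)⁻¹ ≤ 2 * ((sylvester E : ℝ) - 1) := inv_le_of_inv_le₀ (by positivity) h1
  refine le_trans ?_ h4
  rwa [← one_div, le_div_iff₀' (h.pos i hi.le)]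

theorem mem_span_top (h : Circuit P D v β) {i : ℕ} (hi : i ≤ D) :
    v i ∈ Submodule.span ℝ (v '' Iio D) := by
  rcases hi.lt_or_eq with hi | rfl
  · exact Submodule.subset_span ⟨i, hi, rfl⟩
  · have h1 := h.sum_smul
    rw [Finset.sum_range_succ, add_comm, ← eq_neg_iff_add_eq_zero] at h1
    rw [← inv_smul_smul₀ (h.pos i le_rfl).ne' (v i), h1]
    exact Submodule.smul_mem _ _ (Submodule.neg_mem _ (Submodule.sum_mem _ fun j hj =>
      Submodule.smul_mem _ _ (Submodule.subset_span ⟨j, Finset.mem_range.1 hj, rfl⟩)))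

end Circuit

/-- If `d ≥ 4` and `P ⊂ ℝ^d` is a canonical Fano polytope, then
`vol(P*) ≤ 2(s_d - 1)^2 / d!`. -/
theorem dual_volume_le (d : ℕ) (hd : 4 ≤ d) (P : Set (Fin d → ℝ)) (hP : IsCanonicalFano P) :
    volume (polarDual P) ≤
      ENNReal.ofReal (2 * ((sylvester (d - 1) : ℝ) - 1) ^ 2 / (d.factorial : ℝ)) := by
  obtain ⟨⟨V, hV, rfl⟩, hint⟩ := hP
  set P := convexHull ℝ (V : Set (Fin d → ℝ)) with hPdef
  have hconv : Convex ℝ P := convex_convexHull ℝ _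
  have h0 : (0 : Fin d → ℝ) ∈ interior P := by
    have : (0 : Fin d → ℝ) ∈ {x ∈ interior P | IsLatticePt x} := by rw [hint]; rfl
    exact this.1
  let W : Set (Fin d → ℝ) := {x | ∃ D v β, Circuit P D v β ∧ ∃ i < D, v i = x}
  have hspan : Submodule.span ℝ W = ⊤ := by
    refine Submodule.eq_top_of_nonempty_interior' _ ⟨0, interior_mono ?_ h0⟩
    refine convexHull_min (fun x hx => ?_) (Submodule.convex _)
    obtain ⟨D, v, β, h, i, hi, rfl⟩ := exists_circuit hV h0 hx
    refine Submodule.span_mono ?_ (h.mem_span_top hi)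
    rintro _ ⟨j, hj, rfl⟩
    exact ⟨D, v, β, h, j, hj, rfl⟩
  let dims : Set ℕ := {D | ∃ v β, Circuit P D v β}
  have hbdd : BddAbove dims := ⟨d, by rintro D ⟨v, β, h⟩; exact h.le_dim⟩
  obtain ⟨D, hD0, hD⟩ : ∃ D, 0 < D ∧ D ∈ dims := by
    by_contra! hcon
    have : W = ∅ := by
      refine eq_empty_of_forall_notMem ?_
      rintro _ ⟨D, v, β, h, i, hi, rfl⟩
      exact hcon D (by omega) ⟨v, β, h⟩
    rw [this, Submodule.span_empty] at hspan
    have h1 : Module.finrank ℝ (⊤ : Submodule ℝ (Fin d → ℝ)) = 0 := by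
      rw [← hspan]; exact finrank_bot _ _
    simp at h1
    omega
  obtain ⟨k, hk, hmax⟩ : ∃ k ∈ dims, ∀ D ∈ dims, D ≤ k :=
    ⟨sSup dims, Nat.sSup_mem ⟨D, hD⟩ hbdd, fun D hD => le_csSup hbdd hD⟩
  have hk1 : 1 ≤ k := hD0.trans_le (hmax D hD)
  obtain ⟨v, β, h⟩ := hk
  have hβ := h.productSum hconv hint
  have hkd := h.le_dim
  set C := 2 * ((sylvester (k - 1) : ℝ) - 1) with hC
  have hCpos : 0 < C := by
    have := one_le_sylvester_sub_one (k - 1)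
    positivity
  have hW : ∀ x ∈ W, IsLatticePt x ∧ x ∈ P ∧ ∀ y ∈ polarDual P, 1 + dotProduct y x ≤ C := by
    rintro _ ⟨D, v, β, h, i, hi, rfl⟩
    refine ⟨h.lattice i hi.le, h.mem i hi.le, fun y hy => ?_⟩
    refine (h.one_add_le (h.productSum hconv hint) hy hi).trans ?_
    have h1 := sylvester_monotone (Nat.sub_le_sub_right (hmax D ⟨v, β, h⟩) 1)
    have h2 : (sylvester (D - 1) : ℝ) ≤ sylvester (k - 1) := by exact_mod_cast h1
    linarith
  have hli := h.linearIndependent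
  obtain ⟨b, hbW, hsb, hWb, hb⟩ := exists_linearIndepOn_id_extension (t := W)
    hli.linearIndepOn_id (by rintro _ ⟨i, rfl⟩; exact ⟨k, v, β, h, i, i.2, rfl⟩)
  let e : Fin k ⊕ ↥(b \ range fun i : Fin k => v i) ≃ b :=
    ((Equiv.ofInjective _ hli.injective).sumCongr (Equiv.refl _)).trans
      (Equiv.Set.sumDiffSubset hsb)
  have hbspan : ⊤ ≤ Submodule.span ℝ (range ((↑) : b → Fin d → ℝ)) := by
    rw [Subtype.range_coe, ← hspan, Submodule.span_le]
    exact hWb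
  let B := Module.Basis.mk hb hbspan
  have : Finite b := Module.Finite.finite_basis B
  have : Fintype ↥(b \ range fun i : Fin k => v i) := Fintype.ofFinite _
  have hcard : k + Fintype.card ↥(b \ range fun i : Fin k => v i) = d := by
    have := Module.finrank_eq_card_basis (B.reindex e.symm)
    simpa using this.symm
  have hinl : ∀ i, (e (Sum.inl i) : Fin d → ℝ) = v i := fun i => rfl
  have hvol := volume_polarDual_le (P := P) (u := fun s => (e s : Fin d → ℝ)) (β := fun i => β i)
    hcard (fun s => (hW _ (hbW (e s).2)).1) (fun s => (hW _ (hbW (e s).2)).2.1)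
    (hb.comp e e.injective) (fun i => h.pos i i.2.le) hCpos
    (fun y hy => by simpa only [hinl] using h.sum_mul_one_add_le hy)
    (fun y hy j => (hW _ (hbW (e (Sum.inr j)).2)).2.2 y hy)
  refine hvol.trans (ENNReal.ofReal_le_ofReal (le_trans ?_ (prodBound_mul_pow_le hk1 hkd hd)))
  rw [← Finset.prod_range, show Fintype.card _ = d - k by omega, ← hC]
  gcongr
  exact inv_le_of_inv_le₀ (prodBound_pos k) (hβ.inv_prodBound_le hk1)
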